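/- Let 0 ≤ s < 1 and 0 < ε ≤ 1/100. There exists C > 0 depending only on s and ε such that: for every N ≥ 2, every admissible low symbol m (with parameters N, s) with associated multiplier I, and all Schwartz functions u₁, u₂, u₃ : ℝ×ℝ→ℂ, one has ‖I(u₁ \overline{u₂} u₃)‖_{X^{1,−1/2+ε}} ≤ C ‖I u₁‖_{X^{1,1/2+ε}} ‖I u₂‖_{X^{1,1/2+ε}} ‖I u₃‖_{X^{1,1/2+ε}}. -/

import Mathlib

open MeasureTheory Real

noncomputable section

/-- The Fourier transform on `ℝ`: `f̂(ξ) = ∫ e^{-ixξ} f(x) dx`. -/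
def ft (f : ℝ → ℂ) (ξ : ℝ) : ℂ := ∫ x : ℝ, Complex.exp (-Complex.I * x * ξ) * f x

/-- The Japanese bracket `⟨ξ⟩ = 1 + |ξ|`. -/
def jap (ξ : ℝ) : ℝ := 1 + |ξ|

/-- The Sobolev norm `‖f‖_{H^s} = (∫ ⟨ξ⟩^{2s} |f̂(ξ)|² dξ)^{1/2}`. -/
def HsNorm (s : ℝ) (f : ℝ → ℂ) : ℝ :=
  (∫ ξ : ℝ, jap ξ ^ (2 * s) * ‖ft f ξ‖ ^ 2) ^ ((1 : ℝ) / 2)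

/-- The squared `L²` norm. -/
def L2sq (f : ℝ → ℂ) : ℝ := ∫ x : ℝ, ‖f x‖ ^ 2

/-- The spacetime Fourier transform (x first variable, t second). -/
def stft (u : ℝ → ℝ → ℂ) (ξ τ : ℝ) : ℂ :=
  ∫ t : ℝ, ∫ x : ℝ, Complex.exp (-Complex.I * (x * ξ + t * τ)) * u x t

/-- The `X^{s,b}` norm. -/
def XsbNorm (s b : ℝ) (u : ℝ → ℝ → ℂ) : ℝ :=
  (∫ ξ : ℝ, ∫ τ : ℝ,
    jap ξ ^ (2 * s) * jap (τ - ξ ^ 2) ^ (2 * b) * ‖stft u ξ τ‖ ^ 2) ^ ((1 : ℝ) / 2)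

/-- The Fourier multiplier with symbol `θ`: `(mult θ f)̂(ξ) = θ(ξ) f̂(ξ)`. -/
def mult (θ : ℝ → ℝ) (f : ℝ → ℂ) (x : ℝ) : ℂ :=
  (2 * π)⁻¹ • ∫ ξ : ℝ, Complex.exp (Complex.I * x * ξ) * (θ ξ : ℂ) * ft f ξ

/-- The multiplier applied in the `x`-variable of a spacetime function. -/
def multX (θ : ℝ → ℝ) (u : ℝ → ℝ → ℂ) (x t : ℝ) : ℂ := mult θ (fun y => u y t) x

/-- The cubic nonlinearity `F(z) = |z|² z`. -/
def Fnl (z : ℂ) : ℂ := (‖z‖ : ℂ) ^ 2 * z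

/-- The real inner product `⟨f,g⟩ = Re ∫ f ḡ`. -/
def rip (f g : ℝ → ℂ) : ℝ := (∫ x : ℝ, f x * (starRingEnd ℂ) (g x)).re

/-- The Lyapunov functional `L(u) = ∫ |∂ₓu|² + |u|² - ½|u|⁴`. -/
def Lfun (f : ℝ → ℂ) : ℝ :=
  ∫ x : ℝ, (‖deriv f x‖ ^ 2 + ‖f x‖ ^ 2
    - (1 / 2) * ‖f x‖ ^ 4)

/-- The Lyapunov functional with the `H¹`-part expressed on the Fourier side
(Plancherel form), suitable for `H¹` functions. -/
def LfunH1 (f : ℝ → ℂ) : ℝ :=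
  (2 * π)⁻¹ * (∫ ξ : ℝ, (ξ ^ 2 + 1) * ‖ft f ξ‖ ^ 2)
    - (1 / 2) * ∫ x : ℝ, ‖f x‖ ^ 4

/-- Membership in `H¹(ℝ)`. -/
def MemH1 (f : ℝ → ℂ) : Prop :=
  MemLp f 2 (volume : Measure ℝ) ∧
    Integrable (fun ξ : ℝ => jap ξ ^ (2 : ℝ) * ‖ft f ξ‖ ^ 2)

/-- The ground state `Q(x) = 2^{-1/2} / cosh x`. -/
def Qgs (x : ℝ) : ℝ := (Real.sqrt 2)⁻¹ / Real.cosh x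

/-- A point `e^{iα} Q(· - x₀)` of the ground state cylinder. -/
def Qcyl (α x₀ : ℝ) (x : ℝ) : ℂ := Complex.exp (Complex.I * α) * (Qgs (x - x₀) : ℂ)

/-- The ground state cylinder `Σ`. -/
def groundCyl : Set (ℝ → ℂ) := { f | ∃ α x₀ : ℝ, f = Qcyl α x₀ }

/-- `dist_{H^s}(f, Σ)`. -/
def distHs (s : ℝ) (f : ℝ → ℂ) : ℝ :=
  ⨅ v ∈ groundCyl, HsNorm s (fun x => f x - v x)

/-- A smooth function `u(x,t)` all of whose `x`-derivatives are rapidly decreasing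
in `x`, locally uniformly in `t`. -/
structure IsSchwartzInX (u : ℝ → ℝ → ℂ) : Prop where
  smooth : ContDiff ℝ (⊤ : ℕ∞) (fun p : ℝ × ℝ => u p.1 p.2)
  decay : ∀ (k n : ℕ) (T : ℝ), 0 < T → ∃ C : ℝ, ∀ x t : ℝ, |t| ≤ T →
    |x| ^ k * ‖iteratedDeriv n (fun y => u y t) x‖ ≤ C

/-- A smooth Schwartz solution of the focusing cubic NLS `iu_t + u_xx = -|u|²u`. -/
structure IsSchwartzSolution (u : ℝ → ℝ → ℂ) extends IsSchwartzInX u : Prop where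
  eqn : ∀ x t : ℝ, Complex.I * deriv (fun τ => u x τ) t
      + iteratedDeriv 2 (fun y => u y t) x
      = -((‖u x t‖ : ℂ) ^ 2 * u x t)

/-- A Schwartz function on spacetime. -/
def IsSchwartz2 (u : ℝ → ℝ → ℂ) : Prop :=
  ∃ g : SchwartzMap (ℝ × ℝ) ℂ, ∀ x t : ℝ, u x t = g (x, t)

/-- An admissible high symbol `θ` with parameters `N`, `s`. -/
structure AdmissibleHigh (N s : ℝ) (θ : ℝ → ℝ) : Prop where
  smooth : ContDiff ℝ (⊤ : ℕ∞) θ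
  even : ∀ ξ : ℝ, θ (-ξ) = θ ξ
  eq_one : ∀ ξ : ℝ, |ξ| ≤ N → θ ξ = 1
  eq_high : ∀ ξ : ℝ, 2 * N ≤ |ξ| → θ ξ = |ξ| ^ s * N ^ (-s)
  mono : ∀ ξ η : ℝ, |ξ| ≤ |η| → θ ξ ≤ θ η
  deriv1 : ∀ ξ : ℝ, |deriv (fun ζ => θ ζ ^ 2) ξ| ≤ 10 * θ ξ ^ 2 / jap ξ
  deriv2 : ∀ ξ : ℝ, |iteratedDeriv 2 (fun ζ => θ ζ ^ 2) ξ| ≤ 10 * θ ξ ^ 2 / jap ξ ^ 2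

/-- An admissible low symbol `m` with parameters `N`, `s`. -/
structure AdmissibleLow (N s : ℝ) (m : ℝ → ℝ) : Prop where
  smooth : ContDiff ℝ (⊤ : ℕ∞) m
  even : ∀ ξ : ℝ, m (-ξ) = m ξ
  eq_one : ∀ ξ : ℝ, |ξ| ≤ N → m ξ = 1
  eq_high : ∀ ξ : ℝ, 2 * N ≤ |ξ| → m ξ = |ξ| ^ (s - 1) * N ^ (1 - s)
  anti : ∀ ξ η : ℝ, |ξ| ≤ |η| → m η ≤ m ξ
  mono : ∀ ξ η : ℝ, |ξ| ≤ |η| → m ξ * jap ξ ≤ m η * jap η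
  deriv1 : ∀ ξ : ℝ, |deriv m ξ| ≤ 10 * m ξ / jap ξ
  deriv2 : ∀ ξ : ℝ, |iteratedDeriv 2 m ξ| ≤ 10 * m ξ / jap ξ ^ 2

/-- The multilinear form `Λ₄` on the hyperplane `ξ₁+ξ₂+ξ₃+ξ₄ = 0`. -/
def Lam4 (M : ℝ → ℝ → ℝ → ℝ → ℝ) (f₁ f₂ f₃ f₄ : ℝ → ℂ) : ℂ :=
  ∫ ξ₁ : ℝ, ∫ ξ₂ : ℝ, ∫ ξ₃ : ℝ,
    (M ξ₁ ξ₂ ξ₃ (-(ξ₁ + ξ₂ + ξ₃)) : ℂ) * ft f₁ ξ₁ * ft f₂ ξ₂ * ft f₃ ξ₃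
      * ft f₄ (-(ξ₁ + ξ₂ + ξ₃))

/-- The multilinear form `Λ₆` on the hyperplane `ξ₁+⋯+ξ₆ = 0`. -/
def Lam6 (M : ℝ → ℝ → ℝ → ℝ → ℝ → ℝ → ℝ) (f₁ f₂ f₃ f₄ f₅ f₆ : ℝ → ℂ) : ℂ :=
  ∫ ξ₁ : ℝ, ∫ ξ₂ : ℝ, ∫ ξ₃ : ℝ, ∫ ξ₄ : ℝ, ∫ ξ₅ : ℝ,
    (M ξ₁ ξ₂ ξ₃ ξ₄ ξ₅ (-(ξ₁ + ξ₂ + ξ₃ + ξ₄ + ξ₅)) : ℂ) * ft f₁ ξ₁ * ft f₂ ξ₂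
      * ft f₃ ξ₃ * ft f₄ ξ₄ * ft f₅ ξ₅ * ft f₆ (-(ξ₁ + ξ₂ + ξ₃ + ξ₄ + ξ₅))

/-- The complex conjugate of a function. -/
def cj (f : ℝ → ℂ) : ℝ → ℂ := fun x => (starRingEnd ℂ) (f x)

open scoped FourierTransform SchwartzMap

/-- A spacetime Schwartz function, seen on the Euclidean plane. -/
def toPlane (g : 𝓢(ℝ × ℝ, ℂ)) : 𝓢(WithLp 2 (ℝ × ℝ), ℂ) :=
  SchwartzMap.compCLMOfContinuousLinearEquiv ℝ (WithLp.prodContinuousLinearEquiv 2 ℝ ℝ ℝ) g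

lemma toPlane_apply (g : 𝓢(ℝ × ℝ, ℂ)) (z : ℝ × ℝ) : toPlane g (WithLp.toLp 2 z) = g z := rfl

/-- The rescaling which intertwines the two normalisations of the Fourier transform. -/
def dualScale (p : ℝ × ℝ) : WithLp 2 (ℝ × ℝ) := WithLp.toLp 2 ((-(2 * π)⁻¹) • p)

lemma stft_eq_fourierInv (g : 𝓢(ℝ × ℝ, ℂ)) (p : ℝ × ℝ) :
    stft (fun x t => g (x, t)) p.1 p.2 = 𝓕⁻ (toPlane g) (dualScale p) := by
  have h1 : 𝓕⁻ (toPlane g) (dualScale p) = ∫ z : ℝ × ℝ,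
      Complex.exp (-Complex.I * (z.1 * p.1 + z.2 * p.2)) * g z := by
    rw [SchwartzMap.fourierInv_coe, Real.fourierInv_eq',
      ← (WithLp.volume_preserving_toLp ℝ ℝ).integral_comp
        (MeasurableEquiv.toLp 2 (ℝ × ℝ)).measurableEmbedding]
    refine integral_congr_ae (Filter.Eventually.of_forall fun z => ?_)
    simp only [toPlane_apply, smul_eq_mul]
    congr 2
    simp [dualScale, WithLp.prod_inner_apply]
    field_simp
    ring
  have hintegrable : Integrable (fun z : ℝ × ℝ =>
      Complex.exp (-Complex.I * (z.1 * p.1 + z.2 * p.2)) * g z) (volume.prod volume) := by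
    refine (g.integrable (μ := volume)).bdd_mul (c := 1) (by fun_prop) ?_
    refine Filter.Eventually.of_forall fun z => ?_
    rw [Complex.norm_exp]
    simp
  rw [h1, Measure.volume_eq_prod, integral_prod_symm _ hintegrable]
  rfl

lemma stft_mul (f g : 𝓢(ℝ × ℝ, ℂ)) (p : ℝ × ℝ) :
    stft (fun x t => f (x, t) * g (x, t)) p.1 p.2 = (((2 * π) ^ 2)⁻¹ : ℝ) • ∫ q : ℝ × ℝ,
      stft (fun x t => f (x, t)) q.1 q.2 * stft (fun x t => g (x, t)) (p - q).1 (p - q).2 := by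
  have h0 : stft (fun x t => f (x, t) * g (x, t)) p.1 p.2 =
      𝓕⁻ (SchwartzMap.pairing (ContinuousLinearMap.mul ℂ ℂ) (toPlane f) (toPlane g))
        (dualScale p) :=
    stft_eq_fourierInv (SchwartzMap.pairing (ContinuousLinearMap.mul ℂ ℂ) f g) p
  have h1 : 𝓕⁻ (SchwartzMap.pairing (ContinuousLinearMap.mul ℂ ℂ) (toPlane f) (toPlane g)) =
      SchwartzMap.convolution (ContinuousLinearMap.mul ℂ ℂ) (𝓕⁻ (toPlane f)) (𝓕⁻ (toPlane g)) := by
    simp [SchwartzMap.convolution]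
  rw [h0, h1, SchwartzMap.convolution_apply, convolution_def]
  simp_rw [stft_eq_fourierInv]
  rw [← (WithLp.volume_preserving_toLp ℝ ℝ).integral_comp
        (MeasurableEquiv.toLp 2 (ℝ × ℝ)).measurableEmbedding]
  have := Measure.integral_comp_smul (volume : Measure (ℝ × ℝ))
    (fun z => 𝓕⁻ (toPlane f) (WithLp.toLp 2 z) *
      𝓕⁻ (toPlane g) (dualScale p - WithLp.toLp 2 z)) (-(2 * π)⁻¹)
  have hc : |((-(2 * π)⁻¹) ^ Module.finrank ℝ (ℝ × ℝ))⁻¹| = (2 * π) ^ 2 := by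
    simp [abs_of_pos Real.pi_pos]
    field_simp
  have hs : ∀ q, dualScale (p - q) = dualScale p - dualScale q := fun q => by
    simp only [dualScale, smul_sub, WithLp.toLp_sub]
  rw [hc] at this
  simp_rw [hs]
  rw [show (∫ q : ℝ × ℝ, 𝓕⁻ (toPlane f) (dualScale q) *
      𝓕⁻ (toPlane g) (dualScale p - dualScale q)) = _ from this, smul_smul,
    inv_mul_cancel₀ (by positivity), one_smul]
  rfl

lemma IsSchwartz2.conj {u : ℝ → ℝ → ℂ} (hu : IsSchwartz2 u) :
    IsSchwartz2 (fun x t => (starRingEnd ℂ) (u x t)) := by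
  obtain ⟨g, hg⟩ := hu
  exact ⟨SchwartzMap.postcompCLM (𝕜 := ℝ) (Complex.conjCLE : ℂ →L[ℝ] ℂ) g, fun x t => by
    simp [hg]⟩

lemma IsSchwartz2.mul {u v : ℝ → ℝ → ℂ} (hu : IsSchwartz2 u) (hv : IsSchwartz2 v) :
    IsSchwartz2 (fun x t => u x t * v x t) := by
  obtain ⟨g, hg⟩ := hu
  obtain ⟨h, hh⟩ := hv
  exact ⟨SchwartzMap.pairing (ContinuousLinearMap.mul ℂ ℂ) g h, fun x t => by simp [hg, hh]⟩

lemma stft_conj (u : ℝ → ℝ → ℂ) (ξ τ : ℝ) :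
    stft (fun x t => (starRingEnd ℂ) (u x t)) ξ τ = (starRingEnd ℂ) (stft u (-ξ) (-τ)) := by
  simp only [stft, ← integral_conj]
  simp [← Complex.exp_conj, mul_add, add_comm]

/-- The spacetime Fourier transform of a Schwartz function is Schwartz. -/
lemma IsSchwartz2.exists_stft {u : ℝ → ℝ → ℂ} (hu : IsSchwartz2 u) :
    ∃ S : 𝓢(ℝ × ℝ, ℂ), ∀ p : ℝ × ℝ, stft u p.1 p.2 = S p := by
  obtain ⟨g, hg⟩ := hu
  have hπ : (-(2 * π)⁻¹ : ℝ) ≠ 0 := by simp [Real.pi_ne_zero]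
  let e : (ℝ × ℝ) ≃L[ℝ] WithLp 2 (ℝ × ℝ) :=
    (ContinuousLinearEquiv.smulLeft (Units.mk0 (-(2 * π)⁻¹ : ℝ) hπ)).trans
      (WithLp.prodContinuousLinearEquiv 2 ℝ ℝ ℝ).symm
  refine ⟨SchwartzMap.compCLMOfContinuousLinearEquiv ℝ e (𝓕⁻ (toPlane g)), fun p => ?_⟩
  have : u = fun x t => g (x, t) := by ext x t; exact hg x t
  rw [this, stft_eq_fourierInv]
  rfl

lemma one_le_jap (x : ℝ) : 1 ≤ jap x := by simp [jap]

lemma jap_pos (x : ℝ) : 0 < jap x := lt_of_lt_of_le one_pos (one_le_jap x)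

lemma continuous_jap : Continuous jap := by unfold jap; fun_prop

section Symbol

variable {N s : ℝ} {m : ℝ → ℝ}

lemma AdmissibleLow.pos (hm : AdmissibleLow N s m) (hN : 2 ≤ N) (ξ : ℝ) : 0 < m ξ := by
  have hpos : 0 < |ξ| + 2 * N := by positivity
  have h := hm.eq_high (|ξ| + 2 * N) (by rw [abs_of_pos hpos]; linarith [abs_nonneg ξ])
  have h' := hm.anti ξ (|ξ| + 2 * N) (by rw [abs_of_pos hpos]; linarith)
  refine lt_of_lt_of_le ?_ h'
  rw [h, abs_of_pos hpos]
  positivity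

lemma AdmissibleLow.zero_eq_one (hm : AdmissibleLow N s m) (hN : 2 ≤ N) : m 0 = 1 :=
  hm.eq_one 0 (by simp; linarith)

lemma AdmissibleLow.le_one (hm : AdmissibleLow N s m) (hN : 2 ≤ N) (ξ : ℝ) : m ξ ≤ 1 := by
  rw [← hm.zero_eq_one hN]
  exact hm.anti 0 ξ (by simp)

lemma AdmissibleLow.one_le_mul_jap (hm : AdmissibleLow N s m) (hN : 2 ≤ N) (ξ : ℝ) :
    1 ≤ m ξ * jap ξ := by
  have := hm.mono 0 ξ (by simp)
  rwa [hm.zero_eq_one hN, show jap 0 = 1 by simp [jap], one_mul] at this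

lemma AdmissibleLow.mul_jap_le_of_abs_le (hm : AdmissibleLow N s m) (hN : 2 ≤ N) {ξ η : ℝ}
    (h : |ξ| ≤ 3 * |η|) : m ξ * jap ξ ≤ 3 * (m η * jap η) := by
  have h1 : m ξ * jap ξ ≤ m (3 * η) * jap (3 * η) := hm.mono _ _ (by simpa [abs_mul] using h)
  have h2 : m (3 * η) ≤ m η := hm.anti _ _ (by rw [abs_mul]; norm_num; linarith [abs_nonneg η])
  have h3 : jap (3 * η) ≤ 3 * jap η := by simp only [jap, abs_mul]; norm_num; linarith
  calc _ ≤ m (3 * η) * jap (3 * η) := h1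
    _ ≤ m η * (3 * jap η) := mul_le_mul h2 h3 (jap_pos _).le (hm.pos hN _).le
    _ = _ := by ring

/-- The weight `m(ξ)⟨ξ⟩` is submultiplicative along sums of three frequencies. -/
lemma AdmissibleLow.mul_jap_le (hm : AdmissibleLow N s m) (hN : 2 ≤ N) (a b c : ℝ) :
    m (a + b + c) * jap (a + b + c) ≤ 3 * ((m a * jap a) * (m b * jap b) * (m c * jap c)) := by
  have ha := hm.one_le_mul_jap hN a
  have hb := hm.one_le_mul_jap hN b
  have hc := hm.one_le_mul_jap hN c
  have habc : |a + b + c| ≤ |a| + |b| + |c| := abs_add_three a b c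
  have key : |a + b + c| ≤ 3 * |a| ∨ |a + b + c| ≤ 3 * |b| ∨ |a + b + c| ≤ 3 * |c| := by
    by_contra! h
    linarith
  have h1 : ∀ {A B D : ℝ}, 1 ≤ A → 1 ≤ B → 1 ≤ D → A ≤ A * B * D := fun hA hB hD => by
    rw [mul_assoc]
    exact le_mul_of_one_le_right (by linarith) (one_le_mul_of_one_le_of_one_le hB hD)
  rcases key with h | h | h
  · linarith [hm.mul_jap_le_of_abs_le hN h, h1 ha hb hc]
  · linarith [hm.mul_jap_le_of_abs_le hN h, h1 hb ha hc]
  · linarith [hm.mul_jap_le_of_abs_le hN h, h1 hc ha hb]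

end Symbol

lemma integrable_fourier_of_contDiff {G : ℝ → ℂ} (hG : ContDiff ℝ 2 G)
    (hintegrable : ∀ n : ℕ, n ≤ 2 → Integrable (iteratedDeriv n G)) : Integrable (𝓕 G) := by
  have h0 : Integrable G := by simpa using hintegrable 0 (by norm_num)
  have h2 := hintegrable 2 le_rfl
  have hF : 𝓕 (iteratedDeriv 2 G) = fun x : ℝ => (2 * π * Complex.I * x) ^ 2 • 𝓕 G x :=
    Real.fourier_iteratedDeriv (N := 2) hG (fun n hn => hintegrable n (by exact_mod_cast hn))
      (by norm_num)
  have hb : ∀ x, ‖𝓕 G x‖ ≤ ((∫ y, ‖G y‖) + ∫ y, ‖iteratedDeriv 2 G y‖) * (1 + x ^ 2)⁻¹ := by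
    intro x
    have a1 : ‖𝓕 G x‖ ≤ ∫ y, ‖G y‖ :=
      VectorFourier.norm_fourierIntegral_le_integral_norm _ _ _ _ _
    have a2 : ‖𝓕 (iteratedDeriv 2 G) x‖ ≤ ∫ y, ‖iteratedDeriv 2 G y‖ :=
      VectorFourier.norm_fourierIntegral_le_integral_norm _ _ _ _ _
    rw [hF] at a2
    simp only [norm_smul, norm_pow, norm_mul, Complex.norm_I, Complex.norm_real,
      Complex.norm_ofNat, Real.norm_eq_abs, abs_of_pos Real.pi_pos, mul_pow, sq_abs] at a2
    rw [← div_eq_mul_inv, le_div_iff₀ (by positivity)]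
    have : x ^ 2 * ‖𝓕 G x‖ ≤ 2 ^ 2 * π ^ 2 * x ^ 2 * ‖𝓕 G x‖ := by
      gcongr
      exact le_mul_of_one_le_left (sq_nonneg x) (by nlinarith [Real.pi_gt_three])
    linarith
  have hcont : Continuous (𝓕 G) :=
    VectorFourier.fourierIntegral_continuous Real.continuous_fourierChar
      (by exact continuous_inner) h0
  exact (integrable_inv_one_add_sq.const_mul _).mono' hcont.aestronglyMeasurable
    (Filter.Eventually.of_forall hb)

lemma ft_eq_fourier (f : ℝ → ℂ) (ξ : ℝ) : ft f ξ = 𝓕 f ((2 * π)⁻¹ * ξ) := by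
  rw [ft, Real.fourier_real_eq_integral_exp_smul]
  congr 1
  ext x
  rw [smul_eq_mul]
  congr 2
  push_cast
  field_simp

lemma mult_eq_fourierInv (θ : ℝ → ℝ) (f : ℝ → ℂ) (x : ℝ) :
    mult θ f x = (2 * π)⁻¹ • 𝓕⁻ (fun ξ => (θ ξ : ℂ) * ft f ξ) ((2 * π)⁻¹ * x) := by
  rw [mult, Real.fourierInv_eq']
  congr 2
  ext ξ
  rw [smul_eq_mul, ← mul_assoc]
  congr 3
  simp
  field_simp

lemma ft_mult_of_integrable {θ : ℝ → ℝ} {f : ℝ → ℂ} {G : ℝ → ℂ}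
    (hG : ∀ ξ, G ξ = (θ ξ : ℂ) * ft f ξ) (hc : Continuous G) (hi : Integrable G)
    (hF : Integrable (𝓕 G)) (ξ : ℝ) : ft (mult θ f) ξ = (θ ξ : ℂ) * ft f ξ := by
  have hG' : G = fun ξ => (θ ξ : ℂ) * ft f ξ := funext hG
  rw [← hG, ← congrFun (hc.fourier_fourierInv_eq hi hF) ξ, Real.fourier_real_eq_integral_exp_smul,
    ft]
  have := Measure.integral_comp_mul_left
    (fun v : ℝ => Complex.exp (↑(-2 * π * v * ξ) * Complex.I) • 𝓕⁻ G v) (2 * π)⁻¹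
  rw [inv_inv, abs_of_pos (by positivity)] at this
  rw [← inv_smul_eq_iff₀ (by positivity)] at this
  rw [← this, ← integral_smul]
  congr 1
  ext x
  rw [mult_eq_fourierInv, hG', smul_eq_mul, mul_smul_comm]
  congr 3
  push_cast
  field_simp

lemma ft_mult_schwartz {N s : ℝ} {m : ℝ → ℝ} (hm : AdmissibleLow N s m) (hN : 2 ≤ N)
    (f : 𝓢(ℝ, ℂ)) (ξ : ℝ) : ft (mult m f) ξ = (m ξ : ℂ) * ft f ξ := by
  have hπ : ((2 * π)⁻¹ : ℝ) ≠ 0 := by simp [Real.pi_ne_zero]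
  let ψ : 𝓢(ℝ, ℂ) := SchwartzMap.compCLMOfContinuousLinearEquiv ℝ
    (ContinuousLinearEquiv.smulLeft (Units.mk0 ((2 * π)⁻¹ : ℝ) hπ)) (𝓕 f)
  have hψ : ∀ ξ, ψ ξ = ft f ξ := fun ξ => by rw [ft_eq_fourier]; rfl
  have hb0 : ∀ ξ, ‖(m ξ : ℂ)‖ ≤ 10 := fun ξ => by
    rw [Complex.norm_real, Real.norm_eq_abs, abs_of_pos (hm.pos hN ξ)]
    linarith [hm.le_one hN ξ]
  have hb1 : ∀ ξ, ‖((deriv m ξ : ℝ) : ℂ)‖ ≤ 10 := fun ξ => by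
    rw [Complex.norm_real, Real.norm_eq_abs]
    refine (hm.deriv1 ξ).trans ((div_le_iff₀ (jap_pos ξ)).2 ?_)
    linarith [hm.le_one hN ξ, one_le_jap ξ]
  have hb2 : ∀ ξ, ‖((deriv (deriv m) ξ : ℝ) : ℂ)‖ ≤ 10 := fun ξ => by
    rw [Complex.norm_real, Real.norm_eq_abs]
    have := hm.deriv2 ξ
    rw [iteratedDeriv_succ, iteratedDeriv_one] at this
    refine this.trans ((div_le_iff₀ (pow_pos (jap_pos ξ) 2)).2 ?_)
    nlinarith [hm.le_one hN ξ, one_le_jap ξ]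
  have hs1 : ContDiff ℝ (⊤ : ℕ∞) (deriv m) :=
    ((contDiff_infty_iff_deriv).1 hm.smooth).2
  have hs2 : ContDiff ℝ (⊤ : ℕ∞) (deriv (deriv m)) :=
    ((contDiff_infty_iff_deriv).1 hs1).2
  have hd0 : ∀ ξ, HasDerivAt (fun ξ => (m ξ : ℂ)) ((deriv m ξ : ℝ) : ℂ) ξ := fun ξ =>
    ((hm.smooth.differentiable (by simp)) ξ).hasDerivAt.ofReal_comp
  have hd1 : ∀ ξ, HasDerivAt (fun ξ => ((deriv m ξ : ℝ) : ℂ)) ((deriv (deriv m) ξ : ℝ) : ℂ) ξ := fun ξ =>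
    ((hs1.differentiable (by simp)) ξ).hasDerivAt.ofReal_comp
  have key : ∀ {a : ℝ → ℝ} (g : 𝓢(ℝ, ℂ)), ContDiff ℝ (⊤ : ℕ∞) a → (∀ ξ, ‖(a ξ : ℂ)‖ ≤ 10) →
      Integrable fun ξ => (a ξ : ℂ) * g ξ := fun g ha hb =>
    (g.integrable (μ := volume)).bdd_mul (c := 10)
      (Complex.continuous_ofReal.comp ha.continuous).aestronglyMeasurable
      (Filter.Eventually.of_forall hb)
  let D := SchwartzMap.derivCLM ℝ ℂ
  have hD : ∀ (g : 𝓢(ℝ, ℂ)) ξ, HasDerivAt g (D g ξ) ξ := fun g ξ => by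
    rw [SchwartzMap.derivCLM_apply]
    exact g.differentiableAt.hasDerivAt
  have hG1 : deriv (fun ξ => (m ξ : ℂ) * ψ ξ) =
      fun ξ => ((deriv m ξ : ℝ) : ℂ) * ψ ξ + (m ξ : ℂ) * D ψ ξ :=
    funext fun ξ => ((hd0 ξ).mul (hD ψ ξ)).deriv
  have hG2 : deriv (fun ξ => ((deriv m ξ : ℝ) : ℂ) * ψ ξ + (m ξ : ℂ) * D ψ ξ) =
      fun ξ => (((deriv (deriv m) ξ : ℝ) : ℂ) * ψ ξ + ((deriv m ξ : ℝ) : ℂ) * D ψ ξ) +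
        (((deriv m ξ : ℝ) : ℂ) * D ψ ξ + (m ξ : ℂ) * D (D ψ) ξ) :=
    funext fun ξ => (((hd1 ξ).mul (hD ψ ξ)).add ((hd0 ξ).mul (hD (D ψ) ξ))).deriv
  have hi : Integrable fun ξ => (m ξ : ℂ) * ψ ξ := key ψ hm.smooth hb0
  have hcd : ContDiff ℝ 2 fun ξ => (m ξ : ℂ) * ψ ξ :=
    (Complex.ofRealCLM.contDiff.comp (contDiff_infty.1 hm.smooth 2)).mul (ψ.smooth 2)
  refine ft_mult_of_integrable (G := fun ξ => (m ξ : ℂ) * ψ ξ) (fun ξ => by rw [hψ])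
    hcd.continuous hi (integrable_fourier_of_contDiff hcd fun n hn => ?_) ξ
  interval_cases n
  · simpa using hi
  · rw [iteratedDeriv_one, hG1]
    exact (key ψ hs1 hb1).add (key (D ψ) hm.smooth hb0)
  · rw [iteratedDeriv_succ, iteratedDeriv_one, hG1, hG2]
    exact ((key ψ hs2 hb2).add (key (D ψ) hs1 hb1)).add
      ((key (D ψ) hs1 hb1).add (key (D (D ψ)) hm.smooth hb0))

lemma exists_schwartz_slice (g : 𝓢(ℝ × ℝ, ℂ)) (t : ℝ) :
    ∃ f : 𝓢(ℝ, ℂ), ∀ x, f x = g (x, t) := by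
  have hlin : (fun x : ℝ => ((x, 0) : ℝ × ℝ)).HasTemperateGrowth :=
    (ContinuousLinearMap.inl ℝ ℝ ℝ).hasTemperateGrowth
  have hg : (fun x : ℝ => ((x, t) : ℝ × ℝ)).HasTemperateGrowth := by
    have := hlin.add (Function.HasTemperateGrowth.const ((0, t) : ℝ × ℝ))
    convert this using 1
    ext x <;> simp
  exact ⟨SchwartzMap.compCLM ℝ hg ⟨1, 1, fun x => by
    have : ‖x‖ ≤ ‖(x, t)‖ := le_max_left _ _
    linarith⟩ g, fun x => rfl⟩

lemma stft_eq_integral_ft (u : ℝ → ℝ → ℂ) (ξ τ : ℝ) :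
    stft u ξ τ = ∫ t : ℝ, Complex.exp (-Complex.I * t * τ) * ft (fun x => u x t) ξ := by
  unfold stft ft
  congr 1
  ext t
  rw [← integral_const_mul]
  congr 1
  ext x
  rw [← mul_assoc, ← Complex.exp_add]
  congr 2
  ring

lemma stft_multX {N s : ℝ} {m : ℝ → ℝ} (hm : AdmissibleLow N s m) (hN : 2 ≤ N)
    {u : ℝ → ℝ → ℂ} (hu : IsSchwartz2 u) (ξ τ : ℝ) :
    stft (multX m u) ξ τ = (m ξ : ℂ) * stft u ξ τ := by
  obtain ⟨g, hg⟩ := hu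
  rw [stft_eq_integral_ft, stft_eq_integral_ft, ← integral_const_mul]
  congr 1
  ext t
  obtain ⟨f, hf⟩ := exists_schwartz_slice g t
  have h1 : (fun x => u x t) = f := by ext x; rw [hg, hf]
  have h2 : (fun x => multX m u x t) = mult m f := by ext x; rw [multX, h1]
  rw [h1, h2, ft_mult_schwartz hm hN]
  ring

/-- The modulation weight `⟨τ - ξ²⟩`. -/
def modWeight (p : ℝ × ℝ) : ℝ := jap (p.2 - p.1 ^ 2)

lemma one_le_modWeight (p : ℝ × ℝ) : 1 ≤ modWeight p := one_le_jap _

lemma modWeight_pos (p : ℝ × ℝ) : 0 < modWeight p := jap_pos _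

lemma continuous_modWeight : Continuous modWeight :=
  continuous_jap.comp (by fun_prop)

lemma continuous_modWeight_rpow (b : ℝ) : Continuous fun p => modWeight p ^ b :=
  continuous_modWeight.rpow_const fun p => Or.inl (modWeight_pos p).ne'

lemma continuous_jap_rpow (b : ℝ) : Continuous fun x => jap x ^ b :=
  continuous_jap.rpow_const fun x => Or.inl (jap_pos x).ne'

lemma jap_quadratic_rpow_le {r : ℝ} (hr : 0 ≤ r) (a : ℝ) : ∃ c : ℝ, ∀ y : ℝ,
    jap (a - 2 * y ^ 2) ^ (-r) ≤ (1 + (y - c) ^ 2) ^ (-r) + (1 + (y + c) ^ 2) ^ (-r) := by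
  refine ⟨√(max a 0 / 2), fun y => ?_⟩
  set c := √(max a 0 / 2) with hc
  have hc0 : 0 ≤ c := Real.sqrt_nonneg _
  have hc2 : 2 * c ^ 2 = max a 0 := by
    rw [hc, Real.sq_sqrt (by positivity)]
    ring
  have hac : (y - c) ^ 2 ≤ |a - 2 * y ^ 2| ∨ (y + c) ^ 2 ≤ |a - 2 * y ^ 2| := by
    rcases le_total a 0 with ha | ha
    · left
      have hc' : c = 0 := by rw [max_eq_right ha] at hc2; nlinarith
      rw [hc', abs_of_nonpos (by nlinarith [sq_nonneg y])]
      nlinarith [sq_nonneg y]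
    · rw [max_eq_left ha] at hc2
      rcases le_total 0 y with hy | hy
      · left
        rw [← hc2]
        rcases le_total y c with h | h
        · rw [abs_of_nonneg (by nlinarith)]
          nlinarith
        · rw [abs_of_nonpos (by nlinarith)]
          nlinarith
      · right
        rw [← hc2]
        rcases le_total (-y) c with h | h
        · rw [abs_of_nonneg (by nlinarith)]
          nlinarith
        · rw [abs_of_nonpos (by nlinarith)]
          nlinarith
  have h0 : ∀ z : ℝ, 0 ≤ (1 + z ^ 2) ^ (-r) := fun z => by positivity
  have h1 : ∀ z : ℝ, z ^ 2 ≤ |a - 2 * y ^ 2| → jap (a - 2 * y ^ 2) ^ (-r) ≤ (1 + z ^ 2) ^ (-r) :=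
    fun z hz => Real.rpow_le_rpow_of_nonpos (by positivity) (by unfold jap; linarith) (by linarith)
  rcases hac with h | h
  · linarith [h1 _ h, h0 (y + c)]
  · linarith [h1 _ h, h0 (y - c)]

lemma lintegral_jap_quadratic_rpow {r : ℝ} (hr : 1 / 2 < r) : ∃ C : ENNReal, C ≠ ⊤ ∧
    ∀ a c : ℝ, ∫⁻ y : ℝ, ENNReal.ofReal (jap (a - y ^ 2 - (c - y) ^ 2) ^ (-r)) ≤ C := by
  have hintegrable : Integrable fun y : ℝ => (1 + y ^ 2) ^ (-r) := by
    have := integrable_rpow_neg_one_add_norm_sq (E := ℝ) (μ := volume) (r := 2 * r)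
      (by simp; linarith)
    convert this using 2 with y
    rw [Real.norm_eq_abs, sq_abs]
    congr 1
    ring
  refine ⟨(∫⁻ y : ℝ, ENNReal.ofReal ((1 + y ^ 2) ^ (-r))) +
    ∫⁻ y : ℝ, ENNReal.ofReal ((1 + y ^ 2) ^ (-r)), ?_, fun a c => ?_⟩
  · exact ENNReal.add_ne_top.2 ⟨hintegrable.lintegral_lt_top.ne, hintegrable.lintegral_lt_top.ne⟩
  obtain ⟨d, hd⟩ := jap_quadratic_rpow_le (by linarith : (0 : ℝ) ≤ r) (a - c ^ 2 / 2)
  have h1 : ∫⁻ y : ℝ, ENNReal.ofReal (jap (a - y ^ 2 - (c - y) ^ 2) ^ (-r)) =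
      ∫⁻ y : ℝ, ENNReal.ofReal (jap ((a - c ^ 2 / 2) - 2 * y ^ 2) ^ (-r)) := by
    rw [← lintegral_sub_right_eq_self
      (fun y : ℝ => ENNReal.ofReal (jap ((a - c ^ 2 / 2) - 2 * y ^ 2) ^ (-r))) (c / 2)]
    congr! 5
    ring
  rw [h1]
  calc _ ≤ ∫⁻ y : ℝ, (ENNReal.ofReal ((1 + (y - d) ^ 2) ^ (-r)) +
        ENNReal.ofReal ((1 + (y + d) ^ 2) ^ (-r))) := by
        refine lintegral_mono fun y => ?_
        rw [← ENNReal.ofReal_add (by positivity) (by positivity)]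
        exact ENNReal.ofReal_le_ofReal (hd y)
    _ = _ := by
        rw [lintegral_add_left (by fun_prop),
          lintegral_sub_right_eq_self (fun y : ℝ => ENNReal.ofReal ((1 + y ^ 2) ^ (-r))) d,
          lintegral_add_right_eq_self (fun y : ℝ => ENNReal.ofReal ((1 + y ^ 2) ^ (-r))) d]

/-- The Schur-type bound behind the bilinear `L²` estimate: the convolution of the two modulation
weights is uniformly bounded. -/
lemma lintegral_modWeight_kernel {r r' : ℝ} (hr : 1 < r) (hr' : 1 / 2 < r') :
    ∃ C : ENNReal, C ≠ ⊤ ∧ ∀ q : ℝ × ℝ, ∫⁻ p : ℝ × ℝ,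
      ENNReal.ofReal (modWeight p ^ (-r)) * ENNReal.ofReal (modWeight (q - p) ^ (-r')) ≤ C := by
  obtain ⟨C, hC, hb⟩ := lintegral_jap_quadratic_rpow hr'
  have hintegrable : Integrable fun l : ℝ => jap l ^ (-r) :=
    integrable_one_add_norm (E := ℝ) (μ := volume) (by simpa using hr)
  have hm1 := (continuous_modWeight_rpow (-r)).measurable
  have hm2 := (continuous_modWeight_rpow (-r')).measurable
  have hj1 := (continuous_jap_rpow (-r)).measurable
  have hj2 := (continuous_jap_rpow (-r')).measurable
  refine ⟨(∫⁻ l : ℝ, ENNReal.ofReal (jap l ^ (-r))) * C,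
    ENNReal.mul_ne_top hintegrable.lintegral_lt_top.ne hC, fun q => ?_⟩
  have hmeas : Measurable fun p : ℝ × ℝ =>
      ENNReal.ofReal (modWeight p ^ (-r)) * ENNReal.ofReal (modWeight (q - p) ^ (-r')) :=
    hm1.ennreal_ofReal.mul ((hm2.comp (measurable_const.sub measurable_id)).ennreal_ofReal)
  rw [Measure.volume_eq_prod, lintegral_prod _ hmeas.aemeasurable]
  have hshear : ∀ ξ : ℝ, ∫⁻ τ : ℝ, ENNReal.ofReal (modWeight (ξ, τ) ^ (-r)) *
        ENNReal.ofReal (modWeight (q - (ξ, τ)) ^ (-r')) =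
      ∫⁻ l : ℝ, ENNReal.ofReal (jap l ^ (-r)) *
        ENNReal.ofReal (jap (q.2 - l - ξ ^ 2 - (q.1 - ξ) ^ 2) ^ (-r')) := by
    intro ξ
    rw [← lintegral_sub_right_eq_self (fun l : ℝ => ENNReal.ofReal (jap l ^ (-r)) *
        ENNReal.ofReal (jap (q.2 - l - ξ ^ 2 - (q.1 - ξ) ^ 2) ^ (-r'))) (ξ ^ 2)]
    congr! 6 with τ
    simp only [modWeight, Prod.snd_sub, Prod.fst_sub]
    congr 1
    ring
  simp_rw [hshear]
  have hshearm : Measurable fun x : ℝ × ℝ => ENNReal.ofReal (jap x.2 ^ (-r)) *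
      ENNReal.ofReal (jap (q.2 - x.2 - x.1 ^ 2 - (q.1 - x.1) ^ 2) ^ (-r')) :=
    (hj1.comp measurable_snd).ennreal_ofReal.mul
      (hj2.comp (g := fun x : ℝ => jap x ^ (-r')) (f := fun x : ℝ × ℝ =>
        q.2 - x.2 - x.1 ^ 2 - (q.1 - x.1) ^ 2) (by fun_prop)).ennreal_ofReal
  rw [lintegral_lintegral_swap hshearm.aemeasurable, ← lintegral_mul_const _ hj1.ennreal_ofReal]
  refine lintegral_mono fun l => ?_
  rw [lintegral_const_mul' _ _ ENNReal.ofReal_ne_top]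
  gcongr
  exact hb _ _

lemma sq_lintegral_mul_le {α : Type*} [MeasurableSpace α] (μ : Measure α) {f g : α → ENNReal}
    (hf : AEMeasurable f μ) (hg : AEMeasurable g μ) :
    (∫⁻ x, f x * g x ∂μ) ^ 2 ≤ (∫⁻ x, f x ^ 2 ∂μ) * ∫⁻ x, g x ^ 2 ∂μ := by
  have h := ENNReal.lintegral_mul_le_Lp_mul_Lq μ Real.HolderConjugate.two_two hf hg
  have h2 := pow_le_pow_left' h 2
  rw [mul_pow, ← ENNReal.rpow_natCast (_ ^ (1 / 2 : ℝ)), ← ENNReal.rpow_natCast (_ ^ (1 / 2 : ℝ)),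
    ← ENNReal.rpow_mul, ← ENNReal.rpow_mul] at h2
  simpa using h2

section Convolution

variable {f f₁ f₂ f₃ g h W V : ℝ × ℝ → ENNReal} {C : ENNReal}

lemma lintegral_sq_conv_le (hf : Measurable f) (hg : Measurable g) (hW : Measurable W)
    (hV : Measurable V) (hC : ∀ q, ∫⁻ p, (W p * V (q - p)) ^ 2 ≤ C) :
    ∫⁻ q, (∫⁻ p, f p * W p * (g (q - p) * V (q - p))) ^ 2 ≤
      C * ((∫⁻ p, f p ^ 2) * ∫⁻ p, g p ^ 2) := by
  have hpt : ∀ q, (∫⁻ p, f p * W p * (g (q - p) * V (q - p))) ^ 2 ≤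
      C * ∫⁻ p, f p ^ 2 * g (q - p) ^ 2 := by
    intro q
    have h1 : ∫⁻ p, f p * W p * (g (q - p) * V (q - p)) =
        ∫⁻ p, (W p * V (q - p)) * (f p * g (q - p)) := by
      congr! 2 with p
      ring
    rw [h1]
    refine (sq_lintegral_mul_le volume (by fun_prop) (by fun_prop)).trans ?_
    simp_rw [mul_pow (f _)]
    gcongr
    exact hC q
  refine (lintegral_mono hpt).trans ?_
  rw [lintegral_const_mul _ (by fun_prop), lintegral_lintegral_swap (by fun_prop)]
  gcongr
  rw [← lintegral_mul_const _ (by fun_prop)]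
  refine lintegral_mono fun p => ?_
  rw [lintegral_const_mul _ (by fun_prop), lintegral_sub_right_eq_self (fun q => g q ^ 2) p]

/-- The quadrilinear form is the pairing of two bilinear convolutions. -/
lemma sq_quadrilinear_le (hf₁ : Measurable f₁) (hf₂ : Measurable f₂) (hf₃ : Measurable f₃)
    (hh : Measurable h) (hW : Measurable W) (hV : Measurable V) (hWV : ∀ p, W p ≤ V p)
    (hC : ∀ q, ∫⁻ p, (W p * V (q - p)) ^ 2 ≤ C) :
    (∫⁻ p, h p * V p * ∫⁻ r, f₂ r * W r *
        ∫⁻ s, f₁ s * W s * (f₃ (p + r - s) * W (p + r - s))) ^ 2 ≤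
      C ^ 2 * (∫⁻ p, h p ^ 2) *
        ((∫⁻ p, f₁ p ^ 2) * (∫⁻ p, f₂ p ^ 2) * ∫⁻ p, f₃ p ^ 2) := by
  set A : ℝ × ℝ → ENNReal := fun q => ∫⁻ s, f₁ s * W s * (f₃ (q - s) * W (q - s)) with hA
  have hAm : Measurable A := by fun_prop
  have hB : ∫⁻ p, h p * V p * ∫⁻ r, f₂ r * W r * A (p + r) =
      ∫⁻ q, A q * ∫⁻ r, f₂ r * W r * (h (q - r) * V (q - r)) := by
    have e₁ : ∫⁻ p, h p * V p * ∫⁻ r, f₂ r * W r * A (p + r) =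
        ∫⁻ p, ∫⁻ r, h p * V p * (f₂ r * W r * A (p + r)) :=
      lintegral_congr fun p => (lintegral_const_mul _ (by fun_prop)).symm
    have e₂ : ∫⁻ q, A q * ∫⁻ r, f₂ r * W r * (h (q - r) * V (q - r)) =
        ∫⁻ q, ∫⁻ r, A q * (f₂ r * W r * (h (q - r) * V (q - r))) :=
      lintegral_congr fun q => (lintegral_const_mul _ (by fun_prop)).symm
    rw [e₁, e₂, lintegral_lintegral_swap (by fun_prop),
      lintegral_lintegral_swap (f := fun q r => A q * (f₂ r * W r * (h (q - r) * V (q - r))))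
        (by fun_prop)]
    refine lintegral_congr fun r => ?_
    rw [← lintegral_add_right_eq_self
      (fun q => A q * (f₂ r * W r * (h (q - r) * V (q - r)))) r]
    refine lintegral_congr fun p => ?_
    rw [add_sub_cancel_right]
    ring
  have hCW : ∀ q, ∫⁻ p, (W p * W (q - p)) ^ 2 ≤ C := fun q =>
    (lintegral_mono fun p => by gcongr; exact hWV _).trans (hC q)
  rw [hB]
  calc _ ≤ (∫⁻ q, A q ^ 2) * ∫⁻ q, (∫⁻ r, f₂ r * W r * (h (q - r) * V (q - r))) ^ 2 :=
        sq_lintegral_mul_le volume hAm.aemeasurable (by fun_prop)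
    _ ≤ (C * ((∫⁻ p, f₁ p ^ 2) * ∫⁻ p, f₃ p ^ 2)) * (C * ((∫⁻ p, f₂ p ^ 2) * ∫⁻ p, h p ^ 2)) :=
        mul_le_mul' (lintegral_sq_conv_le hf₁ hf₃ hW hW hCW)
          (lintegral_sq_conv_le hf₂ hh hW hV hC)
    _ = _ := by ring

end Convolution

/-- The weighted spacetime Fourier transform whose `L²` norm is `‖I u‖_{X^{1,b}}`. -/
def weightedStft (m : ℝ → ℝ) (b : ℝ) (u : ℝ → ℝ → ℂ) (p : ℝ × ℝ) : ENNReal :=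
  ENNReal.ofReal (m p.1 * jap p.1) * ENNReal.ofReal (modWeight p ^ b) * ‖stft u p.1 p.2‖ₑ

lemma IsSchwartz2.continuous_stft {u : ℝ → ℝ → ℂ} (hu : IsSchwartz2 u) :
    Continuous fun p : ℝ × ℝ => stft u p.1 p.2 := by
  obtain ⟨S, hS⟩ := hu.exists_stft
  simpa only [hS] using S.continuous

lemma measurable_weightedStft {N s : ℝ} {m : ℝ → ℝ} (hm : AdmissibleLow N s m) (b : ℝ)
    {u : ℝ → ℝ → ℂ} (hu : IsSchwartz2 u) : Measurable (weightedStft m b u) := by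
  have h1 : Continuous fun p : ℝ × ℝ => m p.1 * jap p.1 :=
    (hm.smooth.continuous.mul continuous_jap).comp continuous_fst
  exact (h1.measurable.ennreal_ofReal.mul
    (continuous_modWeight_rpow b).measurable.ennreal_ofReal).mul
      hu.continuous_stft.enorm.measurable

lemma modWeight_le (p : ℝ × ℝ) : modWeight p ≤ (1 + ‖p‖) ^ 2 := by
  have h1 : |p.1| ≤ ‖p‖ := norm_fst_le p
  have h2 : |p.2| ≤ ‖p‖ := norm_snd_le p
  have h3 : |p.2 - p.1 ^ 2| ≤ |p.2| + |p.1| ^ 2 := by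
    exact (abs_sub p.2 (p.1 ^ 2)).trans_eq (by rw [abs_pow])
  have h4 : |p.1| ^ 2 ≤ ‖p‖ ^ 2 := by gcongr
  unfold modWeight jap
  nlinarith [norm_nonneg p]

lemma integrable_weight_mul_sq {N s : ℝ} {m : ℝ → ℝ} (hm : AdmissibleLow N s m) (hN : 2 ≤ N)
    {b : ℝ} (hb : b ≤ 1) {u : ℝ → ℝ → ℂ} (hu : IsSchwartz2 u) :
    Integrable fun p : ℝ × ℝ =>
      (m p.1 * jap p.1 * modWeight p ^ b * ‖stft u p.1 p.2‖) ^ 2 := by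
  obtain ⟨S, hS⟩ := hu.exists_stft
  obtain ⟨B, hB⟩ : ∃ B, ∀ p, ‖S p‖ ≤ B := by
    obtain ⟨B, -, hB⟩ := S.decay 0 0
    exact ⟨B, by simpa using hB⟩
  have hcont : Continuous fun p : ℝ × ℝ =>
      (m p.1 * jap p.1 * modWeight p ^ b * ‖stft u p.1 p.2‖) ^ 2 :=
    (((((hm.smooth.continuous.mul continuous_jap).comp continuous_fst).mul
      (continuous_modWeight_rpow b)).mul hu.continuous_stft.norm).pow 2)
  have h0 := (S.integrable (μ := volume)).norm
  have h6 := S.integrable_pow_mul volume 6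
  refine (((h0.add h6).const_mul (2 ^ 5)).const_mul B).mono' hcont.aestronglyMeasurable
    (Filter.Eventually.of_forall fun p => ?_)
  have hm0 := hm.pos hN p.1
  have hj0 := jap_pos p.1
  have hk0 := modWeight_pos p
  have hk : modWeight p ^ b ≤ (1 + ‖p‖) ^ 2 :=
    ((Real.rpow_le_rpow_of_exponent_le (one_le_modWeight p) hb).trans_eq
      (Real.rpow_one _)).trans (modWeight_le p)
  have hj : m p.1 * jap p.1 ≤ 1 + ‖p‖ := by
    have : jap p.1 ≤ 1 + ‖p‖ := by unfold jap; linarith [norm_fst_le p, Real.norm_eq_abs p.1]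
    calc _ ≤ 1 * (1 + ‖p‖) := mul_le_mul (hm.le_one hN _) this hj0.le zero_le_one
      _ = _ := one_mul _
  have hp6 : (1 + ‖p‖) ^ 6 ≤ 2 ^ 5 * (1 + ‖p‖ ^ 6) := by
    simpa using add_pow_le zero_le_one (norm_nonneg p) 6
  rw [Real.norm_of_nonneg (sq_nonneg _), hS]
  calc _ ≤ ((1 + ‖p‖) * (1 + ‖p‖) ^ 2 * ‖S p‖) ^ 2 := by gcongr
    _ = (1 + ‖p‖) ^ 6 * ‖S p‖ * ‖S p‖ := by ring
    _ ≤ (2 ^ 5 * (1 + ‖p‖ ^ 6)) * ‖S p‖ * B := by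
        gcongr
        exact hB p
    _ = _ := by
        simp only [Pi.add_apply]
        ring

lemma weightedStft_sq {N s : ℝ} {m : ℝ → ℝ} (hm : AdmissibleLow N s m) (hN : 2 ≤ N)
    (b : ℝ) (u : ℝ → ℝ → ℂ) (p : ℝ × ℝ) : weightedStft m b u p ^ 2 =
      ENNReal.ofReal ((m p.1 * jap p.1 * modWeight p ^ b * ‖stft u p.1 p.2‖) ^ 2) := by
  have hm0 := hm.pos hN p.1
  have hj0 := jap_pos p.1
  have hk0 := modWeight_pos p
  rw [weightedStft, ← ofReal_norm, ← ENNReal.ofReal_mul (by positivity),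
    ← ENNReal.ofReal_mul (by positivity), ENNReal.ofReal_pow (by positivity)]

lemma lintegral_weightedStft_ne_top {N s : ℝ} {m : ℝ → ℝ} (hm : AdmissibleLow N s m)
    (hN : 2 ≤ N) {b : ℝ} (hb : b ≤ 1) {u : ℝ → ℝ → ℂ} (hu : IsSchwartz2 u) :
    ∫⁻ p, weightedStft m b u p ^ 2 ≠ ⊤ := by
  simp_rw [weightedStft_sq hm hN]
  exact (integrable_weight_mul_sq hm hN hb hu).lintegral_lt_top.ne

lemma XsbNorm_multX {N s : ℝ} {m : ℝ → ℝ} (hm : AdmissibleLow N s m)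
    (hN : 2 ≤ N) {b : ℝ} (hb : b ≤ 1) {u : ℝ → ℝ → ℂ} (hu : IsSchwartz2 u) :
    XsbNorm 1 b (multX m u) = √(∫⁻ p, weightedStft m b u p ^ 2).toReal := by
  have hi := integrable_weight_mul_sq hm hN hb hu
  simp_rw [weightedStft_sq hm hN]
  rw [← ofReal_integral_eq_lintegral_ofReal hi (Filter.Eventually.of_forall fun p => sq_nonneg _),
    ENNReal.toReal_ofReal (integral_nonneg fun p => sq_nonneg _), Real.sqrt_eq_rpow, XsbNorm,
    Measure.volume_eq_prod, integral_prod _ hi]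
  congr! 5 with ξ τ
  have hk0 := modWeight_pos (ξ, τ)
  rw [stft_multX hm hN hu, norm_mul, Complex.norm_real, Real.norm_of_nonneg (hm.pos hN ξ).le,
    mul_one, Real.rpow_ofNat, mul_comm 2 b, Real.rpow_mul (jap_pos _).le, Real.rpow_ofNat]
  simp only [modWeight]
  ring

lemma enorm_stft_mul_le {u v : ℝ → ℝ → ℂ} (hu : IsSchwartz2 u) (hv : IsSchwartz2 v)
    (p : ℝ × ℝ) : ‖stft (fun x t => u x t * v x t) p.1 p.2‖ₑ ≤ ENNReal.ofReal ((2 * π) ^ 2)⁻¹ *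
      ∫⁻ q : ℝ × ℝ, ‖stft u q.1 q.2‖ₑ * ‖stft v (p - q).1 (p - q).2‖ₑ := by
  obtain ⟨f, hf⟩ := hu
  obtain ⟨g, hg⟩ := hv
  have hf' : u = fun x t => f (x, t) := by ext x t; exact hf x t
  have hg' : v = fun x t => g (x, t) := by ext x t; exact hg x t
  rw [hf', hg', stft_mul, enorm_smul, Real.enorm_of_nonneg (by positivity)]
  gcongr
  refine (enorm_integral_le_lintegral_enorm _).trans_eq ?_
  simp_rw [enorm_mul]

lemma enorm_stft_trilinear_le {u₁ u₂ u₃ : ℝ → ℝ → ℂ} (h₁ : IsSchwartz2 u₁)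
    (h₂ : IsSchwartz2 u₂) (h₃ : IsSchwartz2 u₃) (p : ℝ × ℝ) :
    ‖stft (fun x t => u₁ x t * (starRingEnd ℂ) (u₂ x t) * u₃ x t) p.1 p.2‖ₑ ≤
      ENNReal.ofReal ((2 * π) ^ 2)⁻¹ ^ 2 * ∫⁻ r : ℝ × ℝ, ‖stft u₂ r.1 r.2‖ₑ *
        ∫⁻ q : ℝ × ℝ, ‖stft u₁ q.1 q.2‖ₑ * ‖stft u₃ (p + r - q).1 (p + r - q).2‖ₑ := by
  have hcomm : (fun x t => u₁ x t * (starRingEnd ℂ) (u₂ x t) * u₃ x t) =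
      fun x t => (starRingEnd ℂ) (u₂ x t) * (u₁ x t * u₃ x t) := by
    ext x t
    ring
  rw [hcomm]
  refine (enorm_stft_mul_le h₂.conj (h₁.mul h₃) p).trans ?_
  rw [sq (ENNReal.ofReal _), mul_assoc (ENNReal.ofReal _)]
  refine mul_le_mul_right ?_ _
  rw [← lintegral_const_mul' _ _ ENNReal.ofReal_ne_top, ← lintegral_neg_eq_self]
  refine lintegral_mono fun r => ?_
  rw [stft_conj, ← mul_assoc, mul_comm (ENNReal.ofReal _), mul_assoc]
  simp only [Prod.fst_neg, Prod.snd_neg, neg_neg, sub_neg_eq_add, RCLike.enorm_conj]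
  gcongr
  exact enorm_stft_mul_le h₁ h₃ _

lemma weightedStft_mul_modWeight (m : ℝ → ℝ) (b : ℝ) (u : ℝ → ℝ → ℂ) (p : ℝ × ℝ) :
    weightedStft m b u p * ENNReal.ofReal (modWeight p ^ (-b)) =
      ENNReal.ofReal (m p.1 * jap p.1) * ‖stft u p.1 p.2‖ₑ := by
  have hk0 := modWeight_pos p
  have h : ENNReal.ofReal (modWeight p ^ b) * ENNReal.ofReal (modWeight p ^ (-b)) = 1 := by
    rw [← ENNReal.ofReal_mul (by positivity), ← Real.rpow_add hk0]
    simp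
  calc _ = ENNReal.ofReal (m p.1 * jap p.1) * ‖stft u p.1 p.2‖ₑ *
        (ENNReal.ofReal (modWeight p ^ b) * ENNReal.ofReal (modWeight p ^ (-b))) := by
        rw [weightedStft]
        ring
    _ = _ := by rw [h, mul_one]

lemma weightedStft_trilinear_le {N s : ℝ} {m : ℝ → ℝ} (hm : AdmissibleLow N s m) (hN : 2 ≤ N)
    (b b' : ℝ) {u₁ u₂ u₃ : ℝ → ℝ → ℂ} (h₁ : IsSchwartz2 u₁)
    (h₂ : IsSchwartz2 u₂) (h₃ : IsSchwartz2 u₃) (p : ℝ × ℝ) :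
    weightedStft m b' (fun x t => u₁ x t * (starRingEnd ℂ) (u₂ x t) * u₃ x t) p ≤
      (3 * ENNReal.ofReal ((2 * π) ^ 2)⁻¹ ^ 2) * (ENNReal.ofReal (modWeight p ^ b') *
      ∫⁻ r, weightedStft m b u₂ r * ENNReal.ofReal (modWeight r ^ (-b)) *
        ∫⁻ q, weightedStft m b u₁ q * ENNReal.ofReal (modWeight q ^ (-b)) *
          (weightedStft m b u₃ (p + r - q) * ENNReal.ofReal (modWeight (p + r - q) ^ (-b)))) := by
  simp_rw [weightedStft_mul_modWeight]
  set c := ENNReal.ofReal ((2 * π) ^ 2)⁻¹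
  set w : ℝ → ENNReal := fun ξ => ENNReal.ofReal (m ξ * jap ξ) with hw
  have hwfin : ∀ ξ, w ξ ≠ ⊤ := fun ξ => ENNReal.ofReal_ne_top
  have hwmul : ∀ r q : ℝ × ℝ, w p.1 ≤ 3 * (w r.1 * (w q.1 * w (p + r - q).1)) := by
    intro r q
    have h := hm.mul_jap_le hN (-r.1) q.1 (p + r - q).1
    have hpos : ∀ ξ, 0 ≤ m ξ * jap ξ := fun ξ => mul_nonneg (hm.pos hN ξ).le (jap_pos ξ).le
    rw [show -r.1 + q.1 + (p + r - q).1 = p.1 by simp, hm.even,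
      show jap (-r.1) = jap r.1 by simp [jap]] at h
    simp only [hw]
    rw [← ENNReal.ofReal_mul (hpos _), ← ENNReal.ofReal_mul (hpos _),
      show (3 : ENNReal) = ENNReal.ofReal 3 by simp, ← ENNReal.ofReal_mul (by norm_num)]
    refine ENNReal.ofReal_le_ofReal (h.trans_eq ?_)
    ring
  have hmain : w p.1 * ∫⁻ r : ℝ × ℝ, ‖stft u₂ r.1 r.2‖ₑ *
        ∫⁻ q : ℝ × ℝ, ‖stft u₁ q.1 q.2‖ₑ * ‖stft u₃ (p + r - q).1 (p + r - q).2‖ₑ ≤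
      3 * ∫⁻ r : ℝ × ℝ, w r.1 * ‖stft u₂ r.1 r.2‖ₑ * ∫⁻ q : ℝ × ℝ,
        w q.1 * ‖stft u₁ q.1 q.2‖ₑ *
          (w (p + r - q).1 * ‖stft u₃ (p + r - q).1 (p + r - q).2‖ₑ) := by
    rw [← lintegral_const_mul' _ _ (hwfin _), ← lintegral_const_mul' _ _ (by simp)]
    refine lintegral_mono fun r => ?_
    calc _ = ‖stft u₂ r.1 r.2‖ₑ * ∫⁻ q : ℝ × ℝ, w p.1 * (‖stft u₁ q.1 q.2‖ₑ *
          ‖stft u₃ (p + r - q).1 (p + r - q).2‖ₑ) := by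
          rw [lintegral_const_mul' _ _ (hwfin _)]
          ring
      _ ≤ ‖stft u₂ r.1 r.2‖ₑ * ∫⁻ q : ℝ × ℝ, (3 * w r.1) * (w q.1 * ‖stft u₁ q.1 q.2‖ₑ *
          (w (p + r - q).1 * ‖stft u₃ (p + r - q).1 (p + r - q).2‖ₑ)) := by
          refine mul_le_mul_right (lintegral_mono fun q => ?_) _
          refine (mul_le_mul_left (hwmul r q) _).trans_eq ?_
          ring
      _ = _ := by
          rw [lintegral_const_mul' _ _ (ENNReal.mul_ne_top (by simp) (hwfin _))]
          ring
  calc _ ≤ w p.1 * ENNReal.ofReal (modWeight p ^ b') * (c ^ 2 * ∫⁻ r : ℝ × ℝ, ‖stft u₂ r.1 r.2‖ₑ *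
        ∫⁻ q : ℝ × ℝ, ‖stft u₁ q.1 q.2‖ₑ * ‖stft u₃ (p + r - q).1 (p + r - q).2‖ₑ) := by
        unfold weightedStft
        gcongr
        exact enorm_stft_trilinear_le h₁ h₂ h₃ p
    _ = c ^ 2 * ENNReal.ofReal (modWeight p ^ b') * (w p.1 * ∫⁻ r : ℝ × ℝ, ‖stft u₂ r.1 r.2‖ₑ *
        ∫⁻ q : ℝ × ℝ, ‖stft u₁ q.1 q.2‖ₑ * ‖stft u₃ (p + r - q).1 (p + r - q).2‖ₑ) := by ring
    _ ≤ _ := mul_le_mul_right hmain _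
    _ = _ := by
        simp only [hw]
        ring

lemma lintegral_weightedStft_trilinear_le {ε : ℝ} (hε0 : 0 < ε) (hε1 : ε ≤ 1 / 100) :
    ∃ K : ENNReal, K ≠ ⊤ ∧ ∀ {N s : ℝ} {m : ℝ → ℝ}, AdmissibleLow N s m → 2 ≤ N →
      ∀ {u₁ u₂ u₃ : ℝ → ℝ → ℂ}, IsSchwartz2 u₁ → IsSchwartz2 u₂ → IsSchwartz2 u₃ →
      ∫⁻ p, weightedStft m (-(1 / 2) + ε)
          (fun x t => u₁ x t * (starRingEnd ℂ) (u₂ x t) * u₃ x t) p ^ 2 ≤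
        K * ((∫⁻ p, weightedStft m (1 / 2 + ε) u₁ p ^ 2) *
          (∫⁻ p, weightedStft m (1 / 2 + ε) u₂ p ^ 2) *
          ∫⁻ p, weightedStft m (1 / 2 + ε) u₃ p ^ 2) := by
  obtain ⟨C, hC, hker⟩ := lintegral_modWeight_kernel (r := 1 + 2 * ε) (r' := 1 - 2 * ε)
    (by linarith) (by linarith)
  set c := ENNReal.ofReal ((2 * π) ^ 2)⁻¹
  refine ⟨(3 * c ^ 2) ^ 2 * C ^ 2, ?_, fun {N s m} hm hN {u₁ u₂ u₃} h₁ h₂ h₃ => ?_⟩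
  · exact ENNReal.mul_ne_top (ENNReal.pow_ne_top (ENNReal.mul_ne_top (by simp)
      (ENNReal.pow_ne_top ENNReal.ofReal_ne_top))) (ENNReal.pow_ne_top hC)
  set u := fun x t => u₁ x t * (starRingEnd ℂ) (u₂ x t) * u₃ x t
  have hu : IsSchwartz2 u := (h₁.mul h₂.conj).mul h₃
  set W : ℝ × ℝ → ENNReal := fun p => ENNReal.ofReal (modWeight p ^ (-(1 / 2 + ε)))
  set V : ℝ × ℝ → ENNReal := fun p => ENNReal.ofReal (modWeight p ^ (-(1 / 2) + ε))
  have hW : Measurable W := (continuous_modWeight_rpow _).measurable.ennreal_ofReal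
  have hV : Measurable V := (continuous_modWeight_rpow _).measurable.ennreal_ofReal
  have hWV : ∀ p, W p ≤ V p := fun p => ENNReal.ofReal_le_ofReal
    (Real.rpow_le_rpow_of_exponent_le (one_le_modWeight p) (by linarith))
  have hsq : ∀ (a b : ℝ) (p : ℝ × ℝ), 2 * a = b → ENNReal.ofReal (modWeight p ^ a) ^ 2 =
      ENNReal.ofReal (modWeight p ^ b) := fun a b p hab => by
    rw [← ENNReal.ofReal_pow (Real.rpow_nonneg (modWeight_pos p).le _), ← hab, mul_comm 2 a,
      Real.rpow_mul (modWeight_pos p).le, Real.rpow_ofNat]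
  have hWVC : ∀ q, ∫⁻ p, (W p * V (q - p)) ^ 2 ≤ C := fun q => by
    refine le_of_eq_of_le (lintegral_congr fun p => ?_) (hker q)
    rw [mul_pow, hsq _ (-(1 + 2 * ε)) _ (by ring), hsq _ (-(1 - 2 * ε)) _ (by ring)]
  have hquad := sq_quadrilinear_le (measurable_weightedStft hm (1 / 2 + ε) h₁)
    (measurable_weightedStft hm (1 / 2 + ε) h₂) (measurable_weightedStft hm (1 / 2 + ε) h₃)
    (measurable_weightedStft hm (-(1 / 2) + ε) hu) hW hV hWV hWVC
  have hfin := lintegral_weightedStft_ne_top hm hN (b := -(1 / 2) + ε) (by linarith) hu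
  have hle : ∫⁻ p, weightedStft m (-(1 / 2) + ε) u p ^ 2 ≤
      (3 * c ^ 2) * ∫⁻ p, weightedStft m (-(1 / 2) + ε) u p * V p *
        ∫⁻ r, weightedStft m (1 / 2 + ε) u₂ r * W r *
          ∫⁻ q, weightedStft m (1 / 2 + ε) u₁ q * W q *
            (weightedStft m (1 / 2 + ε) u₃ (p + r - q) * W (p + r - q)) := by
    rw [← lintegral_const_mul' _ _ (ENNReal.mul_ne_top (by simp)
      (ENNReal.pow_ne_top ENNReal.ofReal_ne_top))]
    refine lintegral_mono fun p => ?_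
    rw [sq]
    refine (mul_le_mul_right (weightedStft_trilinear_le hm hN (1 / 2 + ε) (-(1 / 2) + ε)
      h₁ h₂ h₃ p) _).trans_eq ?_
    ring
  set X := ∫⁻ p, weightedStft m (-(1 / 2) + ε) u p ^ 2
  rcases eq_or_ne X 0 with hX | hX
  · rw [hX]
    exact zero_le
  have hXX : X * X ≤ X * ((3 * c ^ 2) ^ 2 * C ^ 2 *
      ((∫⁻ p, weightedStft m (1 / 2 + ε) u₁ p ^ 2) *
          (∫⁻ p, weightedStft m (1 / 2 + ε) u₂ p ^ 2) *
          ∫⁻ p, weightedStft m (1 / 2 + ε) u₃ p ^ 2)) := by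
    rw [← sq]
    refine (pow_le_pow_left' hle 2).trans ?_
    rw [mul_pow]
    refine (mul_le_mul_right hquad _).trans_eq ?_
    ring
  exact (ENNReal.mul_le_mul_iff_right hX hfin).1 hXX

/-- trilinear `X^{1,b}` estimate for the smoothing multiplier `I`. -/
theorem trilinear_low
    (s ε : ℝ) (hs0 : 0 ≤ s) (hs1 : s < 1) (hε0 : 0 < ε) (hε1 : ε ≤ 1 / 100) :
    ∃ C : ℝ, 0 < C ∧ ∀ N : ℝ, 2 ≤ N → ∀ m : ℝ → ℝ, AdmissibleLow N s m →
      ∀ u₁ u₂ u₃ : ℝ → ℝ → ℂ, IsSchwartz2 u₁ → IsSchwartz2 u₂ → IsSchwartz2 u₃ →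
      XsbNorm 1 (-(1 / 2) + ε)
          (multX m (fun x t => u₁ x t * (starRingEnd ℂ) (u₂ x t) * u₃ x t))
        ≤ C * XsbNorm 1 (1 / 2 + ε) (multX m u₁) * XsbNorm 1 (1 / 2 + ε) (multX m u₂)
          * XsbNorm 1 (1 / 2 + ε) (multX m u₃) := by
  obtain ⟨K, hK, hmain⟩ := lintegral_weightedStft_trilinear_le hε0 hε1
  refine ⟨√K.toReal + 1, by positivity, fun N hN m hm u₁ u₂ u₃ h₁ h₂ h₃ => ?_⟩
  have hu := (h₁.mul h₂.conj).mul h₃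
  rw [XsbNorm_multX hm hN (by linarith) hu, XsbNorm_multX hm hN (by linarith) h₁,
    XsbNorm_multX hm hN (by linarith) h₂, XsbNorm_multX hm hN (by linarith) h₃]
  have t₁ := lintegral_weightedStft_ne_top hm hN (b := 1 / 2 + ε) (by linarith) h₁
  have t₂ := lintegral_weightedStft_ne_top hm hN (b := 1 / 2 + ε) (by linarith) h₂
  have t₃ := lintegral_weightedStft_ne_top hm hN (b := 1 / 2 + ε) (by linarith) h₃
  have h := ENNReal.toReal_mono
    (ENNReal.mul_ne_top hK (ENNReal.mul_ne_top (ENNReal.mul_ne_top t₁ t₂) t₃))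
    (hmain hm hN h₁ h₂ h₃)
  refine (Real.sqrt_le_sqrt h).trans ?_
  rw [ENNReal.toReal_mul, ENNReal.toReal_mul, ENNReal.toReal_mul,
    Real.sqrt_mul ENNReal.toReal_nonneg, Real.sqrt_mul (by positivity),
    Real.sqrt_mul ENNReal.toReal_nonneg, ← mul_assoc, ← mul_assoc]
  gcongr
  linarith
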